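/- arXiv:1707.09150 — 2 statements merged into one kernel-verified Lean document; each statement's English description precedes it below -/
import Mathlib

section
/- Let n ≥ 2. Then {x ∈ ℝ^n : tr(Y diag(x) Y) ≥ 0 for every n×n real symmetric matrix Y with tr(Y) = 0} = {x ∈ ℝ^n : y^T diag(x) y ≥ 0 for every y ∈ ℝ^n with y_1 + ⋯ + y_n = 0}. -/
open Matrix Finset

theorem dotProduct_diagonal_mulVec {n : ℕ} (x y : Fin n → ℝ) :
    dotProduct y ((Matrix.diagonal x).mulVec y) = ∑ i, x i * y i ^ 2 := by
  simp only [dotProduct, mulVec_diagonal]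
  exact sum_congr rfl fun i _ => by ring

theorem trace_mul_diagonal_mul_self {n : ℕ} (x : Fin n → ℝ) {Y : Matrix (Fin n) (Fin n) ℝ}
    (hY : Y.IsHermitian) :
    (Y * Matrix.diagonal x * Y).trace = ∑ i, ∑ j, x j * Y i j ^ 2 := by
  simp only [trace, diag_apply, Matrix.mul_apply (M := Y * Matrix.diagonal x), mul_diagonal]
  refine sum_congr rfl fun i _ => sum_congr rfl fun j _ => ?_
  have h : Y j i = Y i j := by simpa using hY.apply i j
  rw [h]
  ring

/-- Nonnegativity of the form on `e_i - e_j` gives nonnegative pairwise sums. -/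
theorem add_nonneg_of_nonneg_on_sum_zero {n : ℕ} {x : Fin n → ℝ}
    (hx : ∀ y : Fin n → ℝ, ∑ i, y i = 0 → 0 ≤ ∑ i, x i * y i ^ 2) {i j : Fin n} (hij : i ≠ j) :
    0 ≤ x i + x j := by
  have h := hx (Pi.single i 1 - Pi.single j 1) (by simp)
  have key : ∀ k, x k * (Pi.single i 1 - Pi.single j 1 : Fin n → ℝ) k ^ 2 =
      (if k = i then x k else 0) + (if k = j then x k else 0) := by
    intro k
    by_cases hi : k = i
    · subst hi
      simp [hij]
    · by_cases hj : k = j <;> simp [hi, hj, hij.symm]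
  simp only [key, sum_add_distrib] at h
  simpa using h

/-- For symmetric `Y`, the diagonal part bounds the weighted sum of squares from below when the
pairwise sums of the weights are nonnegative. -/
theorem sum_diag_le_sum_sum {n : ℕ} {x : Fin n → ℝ} {Y : Matrix (Fin n) (Fin n) ℝ}
    (hY : Y.IsHermitian) (hx : ∀ i j, i ≠ j → 0 ≤ x i + x j) :
    ∑ i, x i * Y i i ^ 2 ≤ ∑ i, ∑ j, x j * Y i j ^ 2 := by
  have hswap : ∑ i, ∑ j, x j * Y i j ^ 2 = ∑ i, ∑ j, x i * Y i j ^ 2 := by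
    rw [sum_comm]
    refine sum_congr rfl fun i _ => sum_congr rfl fun j _ => ?_
    have h : Y j i = Y i j := by simpa using hY.apply i j
    rw [h]
  have hle : ∑ i, 2 * (x i * Y i i ^ 2) ≤ ∑ i, ∑ j, (x i * Y i j ^ 2 + x j * Y i j ^ 2) := by
    refine sum_le_sum fun i _ => ?_
    rw [← add_sum_erase _ _ (mem_univ i), two_mul]
    refine le_add_of_nonneg_right (sum_nonneg fun j hj => ?_)
    rw [← add_mul]
    exact mul_nonneg (hx i j (ne_of_mem_erase hj).symm) (sq_nonneg _)
  simp only [sum_add_distrib, ← mul_sum] at hle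
  simp only [← mul_sum] at hswap
  linarith

theorem stmt9 {n : ℕ} (hn : 2 ≤ n) :
    {x : Fin n → ℝ | ∀ Y : Matrix (Fin n) (Fin n) ℝ, Y.IsHermitian → Y.trace = 0 →
        0 ≤ (Y * Matrix.diagonal x * Y).trace} =
      {x : Fin n → ℝ | ∀ y : Fin n → ℝ, ∑ i, y i = 0 →
        0 ≤ dotProduct y ((Matrix.diagonal x).mulVec y)} := by
  ext x
  simp only [Set.mem_ofPred_eq, dotProduct_diagonal_mulVec]
  constructor
  · intro h y hy
    have hH : (Matrix.diagonal y).IsHermitian := isHermitian_diagonal y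
    have h0 := h (Matrix.diagonal y) hH (by simpa [trace_diagonal] using hy)
    simp only [diagonal_mul_diagonal, trace_diagonal] at h0
    exact h0.trans_eq (sum_congr rfl fun i _ => by ring)
  · intro h Y hY htr
    rw [trace_mul_diagonal_mul_self x hY]
    exact (h (fun i => Y i i) htr).trans
      (sum_diag_le_sum_sum hY fun i j hij => add_nonneg_of_nonneg_on_sum_zero h hij)
end

section
/- Let A_1, …, A_n be ℓ×ℓ real symmetric matrices with ℓ ≥ 2, define p : ℝ^n → ℝ by p(x) = det(Σ_{i=1}^n x_i A_i), and suppose e ∈ ℝ^n is such that A_0 = Σ_{i=1}^n e_i A_i is positive definite. Let D_e p(x) denote the directional derivative of p at x in direction e, i.e. D_e p(x) = (d/dt) p(x + t e) |_{t=0}. Let d = ℓ(ℓ+1)/2 − 1, let B_1, …, B_d be a basis of the space of ℓ×ℓ real symmetric matrices with trace zero, and for an ℓ×ℓ real symmetric matrix M let 𝓑(M) be the d×d matrix with (i,j) entry tr(B_i M B_j). Then the hyperbolicity cone Λ_+(D_e p, e) equals {x ∈ ℝ^n : 𝓑(A_0^{−1/2} (Σ_{i=1}^n x_i A_i) A_0^{−1/2})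 is positive semidefinite}; in particular Λ_+(D_e p, e) is a spectrahedral cone with a representation of size ℓ(ℓ+1)/2 − 1. -/
open Matrix Finset
open scoped MatrixOrder

section RealSequences

variable {ι : Type*} [Fintype ι] [DecidableEq ι]

lemma sum_prod_erase_eq_prod_mul_sum_inv {μ : ι → ℝ} (hμ : ∀ i, μ i ≠ 0) :
    ∑ i, ∏ j ∈ univ.erase i, μ j = (∏ i, μ i) * ∑ i, (μ i)⁻¹ := by
  rw [Finset.mul_sum]
  refine Finset.sum_congr rfl fun i _ => ?_
  rw [← Finset.mul_prod_erase univ μ (mem_univ i)]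
  field_simp [hμ i]

lemma sum_prod_erase_eq_of_eq_zero {μ : ι → ℝ} {i : ι} (hi : μ i = 0) :
    ∑ k, ∏ j ∈ univ.erase k, μ j = ∏ j ∈ univ.erase i, μ j := by
  refine Finset.sum_eq_single i (fun k _ hk => ?_) (by simp)
  exact Finset.prod_eq_zero (mem_erase.2 ⟨hk.symm, mem_univ i⟩) hi

lemma exists_sum_zero_of_sum_prod_erase_eq_zero [Nonempty ι] {μ : ι → ℝ}
    (h : ∑ i, ∏ j ∈ univ.erase i, μ j = 0) :
    ∃ y : ι → ℝ, y ≠ 0 ∧ ∑ i, y i = 0 ∧ ∑ i, μ i * y i ^ 2 = 0 := by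
  by_cases hμ : ∀ i, μ i ≠ 0
  · rw [sum_prod_erase_eq_prod_mul_sum_inv hμ] at h
    have hs := (mul_eq_zero.1 h).resolve_left (Finset.prod_ne_zero_iff.2 fun i _ => hμ i)
    refine ⟨fun i => (μ i)⁻¹, fun h0 => ?_, hs, ?_⟩
    · obtain ⟨i⟩ := ‹Nonempty ι›
      exact inv_ne_zero (hμ i) (congrFun h0 i)
    · rw [← hs]
      refine Finset.sum_congr rfl fun i _ => ?_
      field_simp [hμ i]
  · push Not at hμ
    obtain ⟨i, hi⟩ := hμ
    rw [sum_prod_erase_eq_of_eq_zero hi, Finset.prod_eq_zero_iff] at h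
    obtain ⟨j, hj, hj0⟩ := h
    have hji : j ≠ i := (mem_erase.1 hj).1
    refine ⟨Pi.single i 1 - Pi.single j 1, fun h0 => ?_, by simp, ?_⟩
    · simpa [hji.symm] using congrFun h0 i
    · refine Finset.sum_eq_zero fun k _ => ?_
      by_cases hki : k = i
      · simp [hki, hi]
      by_cases hkj : k = j
      · simp [hkj, hj0]
      simp [hki, hkj]

lemma sum_mul_sq_nonneg_of_sum_prod_erase_pos {μ : ι → ℝ} {i : ι} (hμ : ∀ k, k ≠ i → 0 < μ k)
    (h : 0 < ∑ k, ∏ j ∈ univ.erase k, μ j) {y : ι → ℝ} (hy : ∑ k, y k = 0) :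
    0 ≤ ∑ k, μ k * y k ^ 2 := by
  have hT : 0 ≤ ∑ k ∈ univ.erase i, μ k * y k ^ 2 :=
    Finset.sum_nonneg fun k hk => mul_nonneg (hμ k (mem_erase.1 hk).1).le (sq_nonneg _)
  rw [← Finset.add_sum_erase _ _ (mem_univ i)] at hy ⊢
  rcases le_or_gt 0 (μ i) with hi | hi
  · positivity
  have hne : ∀ k, μ k ≠ 0 := fun k => by
    by_cases hk : k = i
    · rw [hk]; exact hi.ne
    · exact (hμ k hk).ne'
  rw [sum_prod_erase_eq_prod_mul_sum_inv hne, ← Finset.mul_prod_erase _ _ (mem_univ i),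
    ← Finset.add_sum_erase _ _ (mem_univ i)] at h
  have hP : 0 < ∏ k ∈ univ.erase i, μ k := Finset.prod_pos fun k hk => hμ k (mem_erase.1 hk).1
  have hS : (μ i)⁻¹ + ∑ k ∈ univ.erase i, (μ k)⁻¹ < 0 :=
    neg_of_mul_pos_right h (mul_neg_of_neg_of_pos hi hP).le
  have hCS : (∑ k ∈ univ.erase i, y k) ^ 2 ≤
      (∑ k ∈ univ.erase i, (μ k)⁻¹) * ∑ k ∈ univ.erase i, μ k * y k ^ 2 := by
    refine Finset.sum_sq_le_sum_mul_sum_of_sq_le_mul _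
      (fun k hk => (inv_pos.2 (hμ k (mem_erase.1 hk).1)).le)
      (fun k hk => mul_nonneg (hμ k (mem_erase.1 hk).1).le (sq_nonneg _)) fun k _ => ?_
    rw [inv_mul_cancel_left₀ (hne k)]
  have hyi : (∑ k ∈ univ.erase i, y k) ^ 2 = y i ^ 2 := by
    rw [eq_neg_of_add_eq_zero_right hy, neg_sq]
  rw [hyi] at hCS
  have hST := mul_le_mul_of_nonneg_right hS.le hT
  have hbound : y i ^ 2 ≤ -(μ i)⁻¹ * ∑ k ∈ univ.erase i, μ k * y k ^ 2 := by linarith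
  have hmul := mul_le_mul_of_nonpos_left hbound hi.le
  rw [← mul_assoc, mul_neg, mul_inv_cancel₀ hi.ne] at hmul
  linarith

lemma exists_forall_ne_nonneg [Nontrivial ι] {a : ι → ℝ}
    (h : ∀ t < 0, 0 < ∑ i, ∏ j ∈ univ.erase i, (a j - t)) :
    ∃ i, ∀ k, k ≠ i → 0 ≤ a k := by
  obtain ⟨i, -, hi⟩ := Finset.exists_min_image univ a univ_nonempty
  obtain ⟨k, hk⟩ := exists_ne i
  obtain ⟨j, hj, hmin⟩ := Finset.exists_min_image (univ.erase i) a
    ⟨k, mem_erase.2 ⟨hk, mem_univ k⟩⟩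
  have hji : j ≠ i := (mem_erase.1 hj).1
  refine ⟨i, fun k hk => le_trans ?_ (hmin k (mem_erase.2 ⟨hk, mem_univ k⟩))⟩
  by_contra! hneg
  have hq := h (a j) hneg
  rw [sum_prod_erase_eq_of_eq_zero (μ := fun k => a k - a j) (sub_self (a j)),
    ← Finset.mul_prod_erase _ _ (mem_erase.2 ⟨hji.symm, mem_univ i⟩)] at hq
  refine hq.not_ge (mul_nonpos_of_nonpos_of_nonneg (sub_nonpos.2 (hi j (mem_univ j)))
    (Finset.prod_nonneg fun k hk => sub_nonneg.2 (hmin k ?_)))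
  simp only [mem_erase] at hk ⊢
  exact ⟨hk.1, mem_univ k⟩

lemma sum_prod_erase_pos_of_roots_nonneg [Nonempty ι] {a : ι → ℝ}
    (h : ∀ t : ℝ, ∑ i, ∏ j ∈ univ.erase i, (a j - t) = 0 → 0 ≤ t) {t : ℝ} (ht : t < 0) :
    0 < ∑ i, ∏ j ∈ univ.erase i, (a j - t) := by
  by_contra! hle
  obtain ⟨i, -, hi⟩ := Finset.exists_min_image univ a univ_nonempty
  have hpos : 0 < ∑ k, ∏ j ∈ univ.erase k, (a j - (min (a i) t - 1)) := by
    refine Finset.sum_pos (fun k _ => Finset.prod_pos fun j _ => ?_) univ_nonempty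
    linarith [hi j (mem_univ j), min_le_left (a i) t]
  have hst : min (a i) t - 1 ≤ t := by linarith [min_le_right (a i) t]
  have hcont : Continuous fun s : ℝ => ∑ k, ∏ j ∈ univ.erase k, (a j - s) := by fun_prop
  obtain ⟨r, hr, hr0⟩ := intermediate_value_Icc' hst hcont.continuousOn ⟨hle, hpos.le⟩
  exact (h r hr0).not_gt (hr.2.trans_lt ht)

/-- The derivative of `∏ i, (a i - t)` has only nonnegative roots if and only if the quadratic form
with coefficients `a` is nonnegative on the hyperplane of vectors whose entries sum to zero. -/
theorem roots_sum_prod_erase_nonneg_iff [Nontrivial ι] (a : ι → ℝ) :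
    (∀ t : ℝ, ∑ i, ∏ j ∈ univ.erase i, (a j - t) = 0 → 0 ≤ t) ↔
      ∀ y : ι → ℝ, ∑ i, y i = 0 → 0 ≤ ∑ i, a i * y i ^ 2 := by
  constructor
  · intro h y hy
    have hpos : ∀ t < 0, 0 < ∑ i, ∏ j ∈ univ.erase i, (a j - t) := fun t ht =>
      sum_prod_erase_pos_of_roots_nonneg h ht
    obtain ⟨i, hi⟩ := exists_forall_ne_nonneg hpos
    have hlt : ∀ t < 0, 0 ≤ ∑ k, (a k - t) * y k ^ 2 := fun t ht =>
      sum_mul_sq_nonneg_of_sum_prod_erase_pos (i := i)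
        (fun k hk => by linarith [hi k hk]) (hpos t ht) hy
    have hcont : Continuous fun t : ℝ => ∑ k, (a k - t) * y k ^ 2 := by fun_prop
    have hlim := (hcont.tendsto 0).mono_left (nhdsWithin_le_nhds (s := Set.Iio 0))
    simpa using ge_of_tendsto hlim (Filter.eventually_of_mem self_mem_nhdsWithin hlt)
  · intro h t ht
    obtain ⟨y, hy0, hy, hsum⟩ := exists_sum_zero_of_sum_prod_erase_eq_zero ht
    by_contra! hneg
    have hsq : 0 < ∑ i, y i ^ 2 := by
      obtain ⟨i, hi⟩ := Function.ne_iff.1 hy0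
      exact Finset.sum_pos' (fun k _ => sq_nonneg _) ⟨i, mem_univ i, sq_pos_of_ne_zero hi⟩
    simp only [sub_mul, Finset.sum_sub_distrib, ← Finset.mul_sum] at hsum
    nlinarith [h y hy]

end RealSequences

namespace Matrix

variable {ι : Type*} [Fintype ι]

lemma IsHermitian.apply_comm {ι : Type*} {Z : Matrix ι ι ℝ} (hZ : Z.IsHermitian) (i j : ι) :
    Z j i = Z i j := by
  simpa using hZ.apply i j

lemma IsHermitian.trace_mul_diagonal_mul_self [DecidableEq ι] {Z : Matrix ι ι ℝ}
    (hZ : Z.IsHermitian) (a : ι → ℝ) :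
    (Z * diagonal a * Z).trace = ∑ i, ∑ j, a i * Z i j ^ 2 := by
  simp only [trace, diag_apply, mul_apply (M := Z * diagonal a), mul_diagonal]
  rw [Finset.sum_comm]
  refine Finset.sum_congr rfl fun i _ => Finset.sum_congr rfl fun j _ => ?_
  rw [hZ.apply_comm i j]
  ring

lemma forall_trace_mul_diagonal_mul_nonneg_iff [DecidableEq ι] (a : ι → ℝ) :
    (∀ Z : Matrix ι ι ℝ, Z.IsHermitian → Z.trace = 0 → 0 ≤ (Z * diagonal a * Z).trace) ↔
      ∀ y : ι → ℝ, ∑ i, y i = 0 → 0 ≤ ∑ i, a i * y i ^ 2 := by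
  constructor
  · intro h y hy
    have hZ := h (diagonal y) (isHermitian_diagonal y) (by simpa [trace_diagonal] using hy)
    convert hZ using 1
    simp only [diagonal_mul_diagonal, trace_diagonal]
    exact Finset.sum_congr rfl fun i _ => by ring
  · intro h Z hZ htr
    have hpair : ∀ i j, i ≠ j → 0 ≤ a i + a j := fun i j hij => by
      have hs := h (Pi.single i 1 - Pi.single j 1) (by simp)
      rw [Finset.sum_eq_add i j hij (fun k _ hk => by simp [hk.1, hk.2]) (by simp) (by simp)] at hs
      simpa [hij, hij.symm] using hs
    have hdiag : 0 ≤ ∑ i, a i * Z i i ^ 2 := h (fun i => Z i i) htr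
    have hswap : ∑ i, ∑ j, a i * Z i j ^ 2 = ∑ i, ∑ j, a j * Z i j ^ 2 := by
      rw [Finset.sum_comm]
      exact Finset.sum_congr rfl fun i _ => Finset.sum_congr rfl fun j _ => by
        rw [hZ.apply_comm i j]
    have hle : ∑ i, 2 * (a i * Z i i ^ 2) ≤ ∑ i, ∑ j, (a i + a j) * Z i j ^ 2 := by
      refine Finset.sum_le_sum fun i _ => ?_
      rw [← Finset.add_sum_erase _ _ (mem_univ i)]
      have hoff : 0 ≤ ∑ j ∈ univ.erase i, (a i + a j) * Z i j ^ 2 :=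
        Finset.sum_nonneg fun j hj =>
          mul_nonneg (hpair i j (mem_erase.1 hj).1.symm) (sq_nonneg _)
      linarith
    simp only [add_mul, Finset.sum_add_distrib, ← Finset.mul_sum] at hle
    rw [hZ.trace_mul_diagonal_mul_self]
    simp only [← Finset.mul_sum] at hswap ⊢
    linarith

lemma IsHermitian.forall_trace_mul_mul_nonneg_iff [DecidableEq ι] {M : Matrix ι ι ℝ}
    (hM : M.IsHermitian) :
    (∀ Y : Matrix ι ι ℝ, Y.IsHermitian → Y.trace = 0 → 0 ≤ (Y * M * Y).trace) ↔
      ∀ y : ι → ℝ, ∑ i, y i = 0 → 0 ≤ ∑ i, hM.eigenvalues i * y i ^ 2 := by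
  rw [← forall_trace_mul_diagonal_mul_nonneg_iff]
  set D := diagonal hM.eigenvalues
  set U : Matrix ι ι ℝ := (hM.eigenvectorUnitary : Matrix ι ι ℝ)
  have hUU : Uᴴ * U = 1 := Unitary.coe_star_mul_self hM.eigenvectorUnitary
  have hUU' : U * Uᴴ = 1 := Unitary.coe_mul_star_self hM.eigenvectorUnitary
  have hspec : M = U * D * Uᴴ := by
    have := hM.spectral_theorem
    rwa [Unitary.conjStarAlgAut_apply] at this
  have hspec' : D = Uᴴ * M * U := by
    rw [hspec]
    simp only [Matrix.mul_assoc, hUU, Matrix.mul_one]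
    rw [← Matrix.mul_assoc, hUU, Matrix.one_mul]
  constructor
  · intro h Z hZ htr
    have := h (U * Z * Uᴴ) (isHermitian_mul_mul_conjTranspose U hZ)
      (by rw [trace_mul_cycle, hUU, Matrix.one_mul, htr])
    convert this using 1
    rw [show U * Z * Uᴴ * M * (U * Z * Uᴴ) = U * (Z * (Uᴴ * M * U) * Z) * Uᴴ by
      simp only [Matrix.mul_assoc], ← hspec', trace_mul_cycle U, hUU, Matrix.one_mul]
  · intro h Y hY htr
    have := h (Uᴴ * Y * U) (isHermitian_conjTranspose_mul_mul U hY)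
      (by rw [trace_mul_cycle, hUU', Matrix.one_mul, htr])
    convert this using 1
    rw [show Uᴴ * Y * U * D * (Uᴴ * Y * U) = Uᴴ * (Y * (U * D * Uᴴ) * Y) * U by
      simp only [Matrix.mul_assoc], ← hspec, trace_mul_cycle Uᴴ, hUU', Matrix.one_mul]

lemma dotProduct_of_trace_mulVec {κ : Type*} [Fintype κ] (B : κ → Matrix ι ι ℝ)
    (M : Matrix ι ι ℝ) (c : κ → ℝ) :
    star c ⬝ᵥ (of fun i j => (B i * M * B j).trace) *ᵥ c =
      ((∑ i, c i • B i) * M * ∑ j, c j • B j).trace := by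
  simp only [dotProduct, mulVec, of_apply, Finset.sum_mul, Finset.mul_sum, trace_sum,
    Matrix.smul_mul, Matrix.mul_smul, trace_smul, smul_eq_mul, Pi.star_apply, star_trivial]
  rw [Finset.sum_comm]
  exact Finset.sum_congr rfl fun i _ => Finset.sum_congr rfl fun j _ => by ring

lemma posSemidef_of_trace_iff {κ : Type*} [Fintype κ] {B : κ → Matrix ι ι ℝ}
    (hBsym : ∀ i, (B i).IsHermitian) (hBtr : ∀ i, (B i).trace = 0)
    (hBspan : ∀ Y : Matrix ι ι ℝ, Y.IsHermitian → Y.trace = 0 →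
      Y ∈ Submodule.span ℝ (Set.range B)) {M : Matrix ι ι ℝ} (hM : M.IsHermitian) :
    (of fun i j => (B i * M * B j).trace : Matrix κ κ ℝ).PosSemidef ↔
      ∀ Y : Matrix ι ι ℝ, Y.IsHermitian → Y.trace = 0 → 0 ≤ (Y * M * Y).trace := by
  have hherm : (of fun i j => (B i * M * B j).trace : Matrix κ κ ℝ).IsHermitian := by
    ext i j
    rw [conjTranspose_apply, of_apply, of_apply, ← trace_conjTranspose, conjTranspose_mul,
      conjTranspose_mul, hBsym i, hBsym j, hM, Matrix.mul_assoc]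
  rw [posSemidef_iff_dotProduct_mulVec, and_iff_right hherm]
  simp only [dotProduct_of_trace_mulVec]
  constructor
  · intro h Y hY htr
    obtain ⟨c, rfl⟩ := (Submodule.mem_span_range_iff_exists_fun ℝ).1 (hBspan Y hY htr)
    exact h c
  · intro h c
    refine h _ ?_ ?_
    · simp only [IsHermitian, conjTranspose_sum, conjTranspose_smul, star_trivial,
        (hBsym _).eq]
    · simp [trace_sum, hBtr]

lemma IsHermitian.det_sub_smul_one [DecidableEq ι] {M : Matrix ι ι ℝ} (hM : M.IsHermitian)
    (t : ℝ) : (M - t • (1 : Matrix ι ι ℝ)).det = ∏ i, (hM.eigenvalues i - t) := by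
  have h := congrArg (Polynomial.eval t) hM.charpoly_eq
  rw [eval_charpoly, Polynomial.eval_prod] at h
  simp only [Polynomial.eval_sub, Polynomial.eval_X, Polynomial.eval_C, RCLike.ofReal_real_eq_id,
    id_eq, scalar_apply, ← smul_one_eq_diagonal] at h
  rw [← neg_sub, det_neg, h, Fintype.card, ← Finset.prod_const, ← Finset.prod_mul_distrib]
  exact Finset.prod_congr rfl fun i _ => by ring

lemma PosDef.isUnit_sqrt [DecidableEq ι] {P : Matrix ι ι ℝ} (hP : P.PosDef) :
    IsUnit (CFC.sqrt P) :=
  (CFC.isUnit_sqrt_iff P hP.posSemidef.nonneg).2 hP.isUnit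

lemma isHermitian_inv_sqrt_mul_mul_inv_sqrt [DecidableEq ι] {P X : Matrix ι ι ℝ}
    (hX : X.IsHermitian) :
    ((CFC.sqrt P)⁻¹ * X * (CFC.sqrt P)⁻¹).IsHermitian := by
  have hS : ((CFC.sqrt P)⁻¹).IsHermitian := (CFC.sqrt_nonneg P).posSemidef.isHermitian.inv
  simpa only [hS.eq] using isHermitian_mul_mul_conjTranspose (CFC.sqrt P)⁻¹ hX

lemma PosDef.det_sub_smul [DecidableEq ι] {P X : Matrix ι ι ℝ} (hP : P.PosDef) (t : ℝ) :
    (X - t • P).det =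
      P.det * ((CFC.sqrt P)⁻¹ * X * (CFC.sqrt P)⁻¹ - t • (1 : Matrix ι ι ℝ)).det := by
  set S := CFC.sqrt P
  have hSdet : IsUnit S.det := (isUnit_iff_isUnit_det S).1 hP.isUnit_sqrt
  have hSS : S * S = P := CFC.sqrt_mul_sqrt_self P hP.posSemidef.nonneg
  have hfac : X - t • P = S * (S⁻¹ * X * S⁻¹ - t • (1 : Matrix ι ι ℝ)) * S := by
    rw [Matrix.mul_sub, Matrix.sub_mul, ← Matrix.mul_assoc, ← Matrix.mul_assoc,
      mul_nonsing_inv S hSdet, Matrix.one_mul, Matrix.mul_assoc X, nonsing_inv_mul S hSdet,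
      Matrix.mul_one, Matrix.mul_smul, Matrix.mul_one, Matrix.smul_mul, hSS]
  rw [hfac, det_mul, det_mul, ← hSS, det_mul]
  ring

end Matrix

lemma deriv_const_mul_prod_sub {ι : Type*} [Fintype ι] [DecidableEq ι] (c : ℝ) (a : ι → ℝ)
    (t : ℝ) :
    deriv (fun s : ℝ => c * ∏ i, (a i - (t - s))) 0 =
      c * ∑ i, ∏ j ∈ univ.erase i, (a j - t) := by
  have h : ∀ i ∈ univ, HasDerivAt (fun s : ℝ => a i - (t - s)) 1 0 := fun i _ => by
    simpa using ((hasDerivAt_id (0 : ℝ)).const_sub t).const_sub (a i)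
  simpa using ((HasDerivAt.fun_finsetProd h).const_mul c).deriv

theorem stmt10 {l n : ℕ} (hl : 2 ≤ l)
    (A : Fin n → Matrix (Fin l) (Fin l) ℝ) (hA : ∀ i, (A i).IsHermitian)
    (e : Fin n → ℝ) (hA0 : (∑ i, e i • A i).PosDef)
    (p : (Fin n → ℝ) → ℝ) (hp : ∀ x, p x = (∑ i, x i • A i).det)
    (Dp : (Fin n → ℝ) → ℝ) (hDp : ∀ x, Dp x = deriv (fun t : ℝ => p (x + t • e)) 0)
    (d : ℕ) (hd : d = l * (l + 1) / 2 - 1)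
    (B : Fin d → Matrix (Fin l) (Fin l) ℝ)
    (hBsym : ∀ i, (B i).IsHermitian)
    (hBtr : ∀ i, (B i).trace = 0)
    (hBli : LinearIndependent ℝ B)
    (hBspan : ∀ M : Matrix (Fin l) (Fin l) ℝ, M.IsHermitian → M.trace = 0 →
      M ∈ Submodule.span ℝ (Set.range B))
    (x : Fin n → ℝ) :
    (∀ t : ℝ, Dp (x - t • e) = 0 → 0 ≤ t) ↔
      (Matrix.of fun i j =>
          (B i * ((CFC.sqrt (∑ i, e i • A i))⁻¹ * (∑ k, x k • A k) * (CFC.sqrt (∑ i, e i • A i))⁻¹) * B j).trace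
        : Matrix (Fin d) (Fin d) ℝ).PosSemidef := by
  have : Nontrivial (Fin l) := Fin.nontrivial_iff_two_le.2 hl
  have hX : (∑ k, x k • A k).IsHermitian := by
    simp only [IsHermitian, conjTranspose_sum, conjTranspose_smul, star_trivial, (hA _).eq]
  have hM := isHermitian_inv_sqrt_mul_mul_inv_sqrt (P := ∑ i, e i • A i) hX
  have hDp_eq : ∀ t : ℝ, Dp (x - t • e) = (∑ i, e i • A i).det *
      ∑ i, ∏ j ∈ univ.erase i, (hM.eigenvalues j - t) := fun t => by
    rw [hDp, ← deriv_const_mul_prod_sub]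
    congr 1
    funext s
    rw [hp, ← hM.det_sub_smul_one, ← hA0.det_sub_smul]
    congr 1
    simp only [Pi.add_apply, Pi.sub_apply, Pi.smul_apply, smul_eq_mul, Finset.smul_sum,
      ← Finset.sum_sub_distrib]
    exact Finset.sum_congr rfl fun i _ => by module
  simp only [hDp_eq, mul_eq_zero, hA0.det_pos.ne', false_or]
  rw [posSemidef_of_trace_iff hBsym hBtr hBspan hM, hM.forall_trace_mul_mul_nonneg_iff,
    roots_sum_prod_erase_nonneg_iff]
end
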